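/- arXiv:1408.5318 — 2 statements merged into one kernel-verified Lean document; each statement's English description precedes it below -/
import Mathlib

section
/- Let P and P′ be disjoint finite subsets of ℝ ∪ {∞}, both of even cardinality. Then the linking number is symmetric: lk(P, P′) = lk(P′, P). -/
/-!
STATEMENT 5. Order `ℝ ∪ {∞}` (here `WithTop ℝ`) so that `∞` is greater than every real
number.  For finite subsets `P, P'` of `ℝ ∪ {∞}` with `P` of even cardinality `2m`, say
`P = {p₁ < … < p_{2m}}`, the linking number is
`lk(P,P') = (−1)^{Σ_{k=1}^m #{x ∈ P' : p_{2k−1} ≤ x ≤ p_{2k}}} ∈ {±1}`.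
For `P, P'` disjoint, an element `x ∈ P'` lies in one of the (pairwise disjoint) intervals
`[p_{2k−1}, p_{2k}]` if and only if the number of elements of `P` that are `≥ x` is odd, so
the exponent above is `#{x ∈ P' : Odd #{p ∈ P : x ≤ p}}`; this is the form used below.

The theorem: for disjoint `P, P'` both of even cardinality, `lk(P,P') = lk(P',P)`.
-/

/-- The linking number of two finite subsets of a linear order:
`(-1)` raised to the number of points of `P'` lying in the union of the intervals
`[p₁,p₂] ∪ [p₃,p₄] ∪ …` determined by the increasing enumeration of `P`
(for `P` even and disjoint from `P'`, membership in that union is equivalent to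
`#{p ∈ P : x ≤ p}` being odd). -/
def lk {α : Type*} [LinearOrder α] (P P' : Finset α) : ℤ :=
  (-1) ^ (P'.filter fun x => Odd (P.filter fun p => x ≤ p).card).card

/-- The linking number is the sign determined by the number of pairs `(x, p) ∈ P' × P`
with `x ≤ p`. -/
theorem lk_eq_prod {α : Type*} [LinearOrder α] (P P' : Finset α) :
    lk P P' = ∏ x ∈ P', ∏ p ∈ P, if x ≤ p then (-1 : ℤ) else 1 := by
  rw [lk, ← Finset.prod_const, Finset.prod_filter]
  refine Finset.prod_congr rfl fun x _ => ?_
  rw [← Finset.prod_filter, Finset.prod_const]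
  split_ifs with h
  · exact h.neg_one_pow.symm
  · exact (Nat.not_odd_iff_even.mp h).neg_one_pow.symm

/-- For disjoint sets, interchanging the arguments changes the linking number by
the sign `(-1) ^ (#P * #P')`. -/
theorem lk_mul_lk {α : Type*} [LinearOrder α] {P P' : Finset α} (hdisj : Disjoint P P') :
    lk P P' * lk P' P = ((-1) ^ P.card) ^ P'.card := by
  rw [lk_eq_prod P P', lk_eq_prod P' P, Finset.prod_comm (s := P), ← Finset.prod_mul_distrib,
    ← Finset.prod_const]
  refine Finset.prod_congr rfl fun x hx => ?_
  rw [← Finset.prod_mul_distrib, ← Finset.prod_const]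
  refine Finset.prod_congr rfl fun p hp => ?_
  rcases (Finset.disjoint_iff_ne.mp hdisj p hp x hx).lt_or_gt with h | h
  · simp [h.le, h.not_ge]
  · simp [h.le, h.not_ge]

/-- The linking number of two disjoint even finite subsets of `ℝ ∪ {∞}` is symmetric. -/
theorem lk_symm (P P' : Finset (WithTop ℝ)) (hdisj : Disjoint P P')
    (hP : Even P.card) (hP' : Even P'.card) :
    lk P P' = lk P' P := by
  have h := lk_mul_lk hdisj
  rw [hP.neg_one_pow, one_pow] at h
  exact Int.eq_of_mul_eq_one h
end

section
/- For every integer n ≥ 2, the number of sign functions s : {(i,j) : 1 ≤ i < j ≤ n} → {−1, +1} for which there exist vectors u₁, …, u_n ∈ ℝ² with det(u_i, u_j) ≠ 0 and s(i,j) = sign(det(u_i, u_j)) for all 1 ≤ i < j ≤ n is exactly 2^{n−1}·(n−1)!. -/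
/-!
STATEMENT 12.  For `u = (u₁,u₂)`, `v = (v₁,v₂)` in `ℝ²`, `det(u,v) = u₁v₂ − u₂v₁`.
For every `n ≥ 2`, the number of sign functions `s` on the pairs `{(i,j) : i < j}` for
which there exist vectors `u₁, …, u_n ∈ ℝ²` with `det(u_i,u_j) ≠ 0` and
`s(i,j) = sign (det(u_i,u_j))` for all `i < j` is exactly `2^{n−1}·(n−1)!`.
-/

/-- `det(u,v) = u₁v₂ − u₂v₁` for `u, v ∈ ℝ²`. -/
def det2 (u v : ℝ × ℝ) : ℝ := u.1 * v.2 - u.2 * v.1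

/-- The sign pattern of a family of plane vectors. -/
noncomputable def signPattern {n : ℕ} (u : Fin n → ℝ × ℝ)
    (p : {p : Fin n × Fin n // p.1 < p.2}) : ℤ :=
  if 0 < det2 (u p.1.1) (u p.1.2) then 1 else -1

theorem signPattern_eq_iff {n : ℕ} (u v : Fin n → ℝ × ℝ) :
    signPattern u = signPattern v ↔
      ∀ i j, i < j → (0 < det2 (u i) (u j) ↔ 0 < det2 (v i) (v j)) := by
  constructor
  · intro h i j hij
    have := congrFun h ⟨(i, j), hij⟩
    simp only [signPattern] at this
    split_ifs at this with h₁ h₂ h₂ <;> simp [h₁, h₂] at this ⊢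
  · intro h
    funext p
    simp only [signPattern, h _ _ p.2]

/-- The vectors `(1, 0)` and `eᵢ • (-σ i, 1)`: up to positive scaling, `e` records on which side of
the first line each vector lies and `σ` the order of slopes of the other lines. -/
noncomputable def standardVectors {m : ℕ} (e : Fin m → ℤˣ) (σ : Equiv.Perm (Fin m)) :
    Fin (m + 1) → ℝ × ℝ :=
  Fin.cons (1, 0) fun i => (-(((e i : ℤ) : ℝ) * ((σ i : ℕ) : ℝ)), ((e i : ℤ) : ℝ))

theorem det2_standardVectors_zero_succ {m : ℕ} (e : Fin m → ℤˣ) (σ : Equiv.Perm (Fin m))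
    (i : Fin m) :
    det2 (standardVectors e σ 0) (standardVectors e σ i.succ) = ((e i : ℤ) : ℝ) := by
  simp [standardVectors, det2]

theorem det2_standardVectors_succ_succ {m : ℕ} (e : Fin m → ℤˣ) (σ : Equiv.Perm (Fin m))
    (i j : Fin m) :
    det2 (standardVectors e σ i.succ) (standardVectors e σ j.succ) =
      ((e i : ℤ) : ℝ) * ((e j : ℤ) : ℝ) * (((σ j : ℕ) : ℝ) - ((σ i : ℕ) : ℝ)) := by
  simp only [standardVectors, det2, Fin.cons_succ]
  ring

theorem det2_standardVectors_ne_zero {m : ℕ} (e : Fin m → ℤˣ) (σ : Equiv.Perm (Fin m))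
    {i j : Fin (m + 1)} (hij : i < j) :
    det2 (standardVectors e σ i) (standardVectors e σ j) ≠ 0 := by
  obtain ⟨j, rfl⟩ := Fin.exists_succ_eq.2 (Fin.ne_zero_of_lt hij)
  cases i using Fin.cases with
  | zero => simp [det2_standardVectors_zero_succ]
  | succ i =>
    rw [det2_standardVectors_succ_succ]
    have hne : (σ j : ℕ) ≠ σ i := fun h =>
      (Fin.succ_lt_succ_iff.1 hij).ne' (σ.injective (Fin.ext h))
    simp [sub_eq_zero, hne]

theorem Equiv.Perm.eq_of_lt_iff_lt {m : ℕ} {σ τ : Equiv.Perm (Fin m)}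
    (h : ∀ i j, i < j → (σ i < σ j ↔ τ i < τ j)) : σ = τ := by
  have h' : ∀ i j, σ i < σ j ↔ τ i < τ j := by
    intro i j
    rcases lt_trichotomy i j with hij | rfl | hij
    · exact h i j hij
    · simp
    · have hσ : σ i ≠ σ j := σ.injective.ne hij.ne'
      have hτ : τ i ≠ τ j := τ.injective.ne hij.ne'
      have := h j i hij
      grind
  have hmono : StrictMono (τ ∘ σ.symm) := fun a b hab => by
    simpa [hab] using h' (σ.symm a) (σ.symm b)
  ext i
  simpa using congrArg Fin.val (congrFun hmono.eq_id (σ i)).symm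

theorem signPattern_standardVectors_injective (m : ℕ) :
    Function.Injective fun x : (Fin m → ℤˣ) × Equiv.Perm (Fin m) =>
      signPattern (standardVectors x.1 x.2) := by
  rintro ⟨e, σ⟩ ⟨f, τ⟩ h
  have h := (signPattern_eq_iff _ _).1 h
  have hef : e = f := by
    funext i
    have := h 0 i.succ (Fin.succ_pos i)
    simp only [det2_standardVectors_zero_succ] at this
    rcases Int.units_eq_one_or (e i) with he | he <;>
    rcases Int.units_eq_one_or (f i) with hf | hf <;>
    first | exact he.trans hf.symm | norm_num [he, hf] at this
  subst hef
  refine Prod.ext rfl (Equiv.Perm.eq_of_lt_iff_lt fun i j hij => ?_)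
  have := h i.succ j.succ (Fin.succ_lt_succ_iff.2 hij)
  simp only [det2_standardVectors_succ_succ] at this
  have hσ : σ i ≠ σ j := σ.injective.ne hij.ne
  have hτ : τ i ≠ τ j := τ.injective.ne hij.ne
  rcases Int.units_eq_one_or (e i) with he | he <;>
  rcases Int.units_eq_one_or (e j) with hf | hf <;>
  simp [he, hf] at this <;> grind

theorem exists_perm_lt_iff_lt {m : ℕ} {x : Fin m → ℝ} (hx : Function.Injective x) :
    ∃ σ : Equiv.Perm (Fin m), ∀ i j, σ i < σ j ↔ x i < x j := by
  have hs : StrictMono (x ∘ Tuple.sort x) :=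
    (Tuple.monotone_sort x).strictMono_of_injective (hx.comp (Tuple.sort x).injective)
  refine ⟨(Tuple.sort x).symm, fun i j => ?_⟩
  simpa using (hs.lt_iff_lt (a := (Tuple.sort x).symm i) (b := (Tuple.sort x).symm j)).symm

theorem det2_ne_zero_left {u v : ℝ × ℝ} (h : det2 u v ≠ 0) : 0 < u.1 ^ 2 + u.2 ^ 2 := by
  by_contra hle
  have h1 : u.1 = 0 := by nlinarith [sq_nonneg u.1, sq_nonneg u.2]
  have h2 : u.2 = 0 := by nlinarith [sq_nonneg u.1, sq_nonneg u.2]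
  simp [det2, h1, h2] at h

theorem sq_add_sq_mul_det2 {u v w : ℝ × ℝ} (hv : det2 u v ≠ 0) (hw : det2 u w ≠ 0) :
    (u.1 ^ 2 + u.2 ^ 2) * det2 v w = det2 u v * det2 u w *
      (-(u.1 * w.1 + u.2 * w.2) / det2 u w - -(u.1 * v.1 + u.2 * v.2) / det2 u v) := by
  field_simp
  simp only [det2]
  ring

theorem exists_signPattern_standardVectors_eq {m : ℕ} (u : Fin (m + 1) → ℝ × ℝ)
    (hu : ∀ i j, i < j → det2 (u i) (u j) ≠ 0) :
    ∃ e σ, signPattern (standardVectors (m := m) e σ) = signPattern u := by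
  have h0 (i : Fin m) : det2 (u 0) (u i.succ) ≠ 0 := hu _ _ (Fin.succ_pos i)
  set x : Fin m → ℝ := fun i =>
    -((u 0).1 * (u i.succ).1 + (u 0).2 * (u i.succ).2) / det2 (u 0) (u i.succ)
  have key (i j : Fin m) : ((u 0).1 ^ 2 + (u 0).2 ^ 2) * det2 (u i.succ) (u j.succ) =
      det2 (u 0) (u i.succ) * det2 (u 0) (u j.succ) * (x j - x i) :=
    sq_add_sq_mul_det2 (h0 i) (h0 j)
  have hne (i j : Fin m) (hij : i < j) : x i ≠ x j := fun h => by
    have hk := key i j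
    rw [h, sub_self, mul_zero] at hk
    exact mul_ne_zero (det2_ne_zero_left (h0 i)).ne'
      (hu _ _ (Fin.succ_lt_succ_iff.2 hij)) hk
  have hx : Function.Injective x := fun i j h => by
    rcases lt_trichotomy i j with hij | hij | hij
    · exact absurd h (hne i j hij)
    · exact hij
    · exact absurd h.symm (hne j i hij)
  obtain ⟨σ, hσ⟩ := exists_perm_lt_iff_lt hx
  refine ⟨fun i => if 0 < det2 (u 0) (u i.succ) then 1 else -1, σ,
    (signPattern_eq_iff _ _).2 fun i j hij => ?_⟩
  obtain ⟨j, rfl⟩ := Fin.exists_succ_eq.2 (Fin.ne_zero_of_lt hij)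
  cases i using Fin.cases with
  | zero =>
    rw [det2_standardVectors_zero_succ]
    split_ifs with h <;> norm_num [h]
  | succ i =>
    rw [det2_standardVectors_succ_succ,
      ← mul_pos_iff_of_pos_left (det2_ne_zero_left (h0 i)) (b := det2 (u i.succ) (u j.succ)),
      key i j]
    have hneg {a b : ℝ} (ha : a < 0) : 0 < a * b ↔ b < 0 := smul_pos_iff_of_neg_left ha
    have hij' := hσ i j
    have hji' := hσ j i
    rcases (h0 i).lt_or_gt with hi | hi <;> rcases (h0 j).lt_or_gt with hj | hj
    · simp [hi.not_gt, hj.not_gt, mul_pos_iff_of_pos_left (mul_pos_of_neg_of_neg hi hj), hij']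
    · simp [hi.not_gt, hj, hneg (mul_neg_of_neg_of_pos hi hj), hji']
    · simp [hi, hj.not_gt, hneg (mul_neg_of_pos_of_neg hi hj), hji']
    · simp [hi, hj, mul_pos_iff_of_pos_left (mul_pos hi hj), hij']

theorem realizable_sign_patterns (n : ℕ) (hn : 2 ≤ n) :
    Nat.card {s : {p : Fin n × Fin n // p.1 < p.2} → ℤ //
        ∃ u : Fin n → ℝ × ℝ,
          ∀ p : {p : Fin n × Fin n // p.1 < p.2},
            det2 (u p.1.1) (u p.1.2) ≠ 0 ∧
            s p = if 0 < det2 (u p.1.1) (u p.1.2) then 1 else -1} =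
      2 ^ (n - 1) * Nat.factorial (n - 1) := by
  obtain ⟨m, rfl⟩ : ∃ m, n = m + 1 := ⟨n - 1, by omega⟩
  rw [← Nat.card_congr (Equiv.ofBijective
    (fun x : (Fin m → ℤˣ) × Equiv.Perm (Fin m) => ⟨signPattern (standardVectors x.1 x.2),
      standardVectors x.1 x.2, fun p => ⟨det2_standardVectors_ne_zero x.1 x.2 p.2, rfl⟩⟩) ⟨?_, ?_⟩)]
  · simp [Nat.card_eq_fintype_card, Fintype.card_perm]
  · intro x y h
    exact signPattern_standardVectors_injective m (congrArg Subtype.val h)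
  · rintro ⟨s, u, hu⟩
    obtain ⟨e, σ, h⟩ := exists_signPattern_standardVectors_eq u
      fun i j hij => (hu ⟨(i, j), hij⟩).1
    exact ⟨(e, σ), Subtype.ext (h.trans (funext fun p => (hu p).2.symm))⟩
end
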